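/- Let A_{-1}, A_0, A_1, G be as in the context, with G𝟙 = 𝟙, and let σ < 1 be a real number such that (A_{-1} − A_1)𝟙 ≥ (1 − σ)𝟙 entrywise. Then I − A_0 is invertible in B(ℓ∞), and the sequence X : ℕ → B(ℓ∞) defined by X_0 = 0 and X_{k+1} = (I − A_0)^{-1}(A_{-1} + A_1 X_k²) satisfies, for every k: (i) 0 ≤ X_k ≤ X_{k+1} ≤ G; (ii) ‖G − X_{k+1}‖ ≤ ‖(I − A_0)^{-1}(A_1 + A_1G)‖ · ‖G − X_k‖; and (iii) ‖G − X_k‖ → 0 as k → ∞. -/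

import Mathlib

open BoundedContinuousFunction Filter

noncomputable section

/-- ℓ∞: the Banach space of bounded real sequences with the sup norm. -/
abbrev Linf : Type := BoundedContinuousFunction ℕ ℝ

/-- A sequence is nonnegative if all its entries are nonnegative. -/
def vnonneg (x : Linf) : Prop := ∀ i, 0 ≤ x i

/-- An operator in B(ℓ∞) is positive if it maps nonnegative sequences to
nonnegative sequences. -/
def OpPos (A : Linf →L[ℝ] Linf) : Prop := ∀ x : Linf, vnonneg x → vnonneg (A x)

/-- The constant sequence with all entries equal to one. -/
def ones : Linf := BoundedContinuousFunction.const ℕ (1 : ℝ)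

namespace OpPos

variable {P Q : Linf →L[ℝ] Linf}

theorem mono (hP : OpPos P) {x y : Linf} (h : ∀ i, x i ≤ y i) (i : ℕ) : P x i ≤ P y i := by
  have := hP (y - x) (fun j => by simpa using h j) i
  simpa using this

theorem zero : OpPos 0 := fun _ _ _ => le_rfl

theorem one : OpPos 1 := fun _ hx => hx

theorem add (hP : OpPos P) (hQ : OpPos Q) : OpPos (P + Q) :=
  fun x hx i => add_nonneg (hP x hx i) (hQ x hx i)

theorem mul (hP : OpPos P) (hQ : OpPos Q) : OpPos (P * Q) :=
  fun x hx => hP _ (hQ x hx)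

theorem pow (hP : OpPos P) (n : ℕ) : OpPos (P ^ n) := by
  induction n with
  | zero => exact one
  | succ n ih => rw [pow_succ]; exact ih.mul hP

theorem apply_ones_nonneg (hP : OpPos P) (i : ℕ) : 0 ≤ P ones i :=
  hP ones (fun _ => zero_le_one) i

theorem norm_le (hP : OpPos P) {c : ℝ} (h : ∀ i, P ones i ≤ c) : ‖P‖ ≤ c := by
  have hc : 0 ≤ c := (hP.apply_ones_nonneg 0).trans (h 0)
  refine P.opNorm_le_bound hc fun x => ?_
  refine (BoundedContinuousFunction.norm_le (by positivity)).2 fun i => ?_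
  have hx : ∀ j, |x j| ≤ ‖x‖ := fun j => x.norm_coe_le_norm j
  have h1 : P x i ≤ P (‖x‖ • ones) i :=
    hP.mono (fun j => by simpa [ones] using (abs_le.1 (hx j)).2) i
  have h2 : P (-(‖x‖ • ones)) i ≤ P x i :=
    hP.mono (fun j => by simpa [ones] using (abs_le.1 (hx j)).1) i
  have h3 : ‖x‖ * P ones i ≤ c * ‖x‖ := by
    rw [mul_comm c]; exact mul_le_mul_of_nonneg_left (h i) (norm_nonneg x)
  simp only [map_neg, map_smul, BoundedContinuousFunction.coe_neg, Pi.neg_apply,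
    BoundedContinuousFunction.coe_smul, smul_eq_mul] at h1 h2
  rw [Real.norm_eq_abs, abs_le]
  constructor <;> linarith

theorem apply_ones_le_norm (P : Linf →L[ℝ] Linf) (i : ℕ) : P ones i ≤ ‖P‖ := by
  have h1 : ‖ones‖ ≤ 1 :=
    (BoundedContinuousFunction.norm_le zero_le_one).2 fun i => by simp [ones]
  calc P ones i ≤ ‖P ones‖ := (le_abs_self _).trans ((P ones).norm_coe_le_norm i)
    _ ≤ ‖P‖ * ‖ones‖ := P.le_opNorm _
    _ ≤ ‖P‖ := mul_le_of_le_one_right (norm_nonneg P) h1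

theorem of_hasSum {f : ℕ → Linf →L[ℝ] Linf} (hf : ∀ n, OpPos (f n)) (h : HasSum f P) :
    OpPos P := by
  intro x hx i
  have := h.mapL ((BoundedContinuousFunction.evalCLM ℝ i).comp
    (ContinuousLinearMap.apply ℝ Linf x))
  exact this.nonneg fun n => hf n x hx i

/-- A positive operator of norm less than one has a positive Neumann inverse. -/
theorem exists_inverse_one_sub (hP : OpPos P) (h : ‖P‖ < 1) :
    ∃ B : Linf →L[ℝ] Linf, (1 - P) * B = 1 ∧ B * (1 - P) = 1 ∧ OpPos B :=
  ⟨∑' n, P ^ n, mul_neg_geom_series P h, geom_series_mul_neg P h,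
    of_hasSum hP.pow (summable_geometric_of_norm_lt_one (x := P) h).hasSum⟩

end OpPos

section Ring

variable {R : Type*} [Ring R]

theorem eq_mul_of_quadratic_eq {a₁ a₀ m g b : R} (hb : b * (1 - a₀) = 1)
    (h : a₁ * g ^ 2 + a₀ * g + m = g) : g = b * (m + a₁ * g ^ 2) := by
  have h' : m + a₁ * g ^ 2 = (1 - a₀) * g := by
    rw [sub_mul, one_mul, eq_sub_iff_add_eq]
    nth_rewrite 3 [← h]
    abel
  rw [h', ← mul_assoc, hb, one_mul]

theorem quadratic_step_sub (b m a g x : R) :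
    b * (m + a * g ^ 2) - b * (m + a * x ^ 2) = b * (a * (g * (g - x) + (g - x) * x)) := by
  noncomm_ring

theorem eq_one_add_mul_of_mul_one_sub {a b : R} (hb : b * (1 - a) = 1) : b = 1 + b * a := by
  rw [← hb, mul_sub, mul_one, sub_add_cancel]

end Ring

/-- Fixed point iteration F₂: I - A₀ is invertible and the iteration converges
monotonically and linearly starting from X₀ = 0. -/
theorem stmt1
    (Am1 A0 A1 G : Linf →L[ℝ] Linf)
    (hAm1 : OpPos Am1) (hA0 : OpPos A0) (hA1 : OpPos A1) (hG : OpPos G)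
    (hstoch : (Am1 + A0 + A1) ones = ones)
    (heq : A1 * G ^ 2 + A0 * G + Am1 = G)
    (hG1 : G ones = ones)
    (σ : ℝ) (hσ : σ < 1)
    (hgap : ∀ i, 1 - σ ≤ ((Am1 - A1) ones) i) :
    ∃ B : Linf →L[ℝ] Linf, (1 - A0) * B = 1 ∧ B * (1 - A0) = 1 ∧
      ∀ X : ℕ → Linf →L[ℝ] Linf, X 0 = 0 →
        (∀ k, X (k + 1) = B * (Am1 + A1 * (X k) ^ 2)) →
        (∀ k, OpPos (X k) ∧ OpPos (X (k + 1) - X k) ∧ OpPos (G - X k)) ∧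
        (∀ k, ‖G - X (k + 1)‖ ≤ ‖B * (A1 + A1 * G)‖ * ‖G - X k‖) ∧
        Tendsto (fun k => ‖G - X k‖) atTop (nhds 0) := by
  have hst : ∀ i, Am1 ones i + A0 ones i + A1 ones i = 1 := fun i => by
    simpa [ones] using congrArg (fun x : Linf => x i) hstoch
  have hgap' : ∀ i, 1 - σ ≤ Am1 ones i - A1 ones i := fun i => by simpa using hgap i
  have hA0σ : ∀ i, A0 ones i ≤ σ := fun i => by
    linarith [hst i, hgap' i, hA1.apply_ones_nonneg i]
  have hσ0 : 0 ≤ σ := (hA0.apply_ones_nonneg 0).trans (hA0σ 0)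
  obtain ⟨B, hB1, hB2, hB⟩ := hA0.exists_inverse_one_sub ((hA0.norm_le hA0σ).trans_lt hσ)
  refine ⟨B, hB1, hB2, fun X hX0 hX => ?_⟩
  have hGfix : G = B * (Am1 + A1 * G ^ 2) :=
    eq_mul_of_quadratic_eq (R := Linf →L[ℝ] Linf) hB2 heq
  have hdiff : ∀ k, G - X (k + 1) = B * (A1 * (G * (G - X k) + (G - X k) * X k)) := fun k => by
    rw [hX k]
    nth_rewrite 1 [hGfix]
    exact quadratic_step_sub (R := Linf →L[ℝ] Linf) B Am1 A1 G (X k)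
  have hpos : ∀ k, OpPos (X k) ∧ OpPos (X (k + 1) - X k) ∧ OpPos (G - X k) := by
    intro k
    induction k with
    | zero =>
      have hsub : ∀ P : Linf →L[ℝ] Linf, P - 0 = P := fun P => sub_zero P
      rw [hX 0, hX0, hsub, hsub]
      exact ⟨OpPos.zero, hB.mul (hAm1.add (hA1.mul (OpPos.zero.pow 2))), hG⟩
    | succ k ih =>
      obtain ⟨h1, h2, h3⟩ := ih
      have h1' : OpPos (X (k + 1)) := by
        rw [hX k]; exact hB.mul (hAm1.add (hA1.mul (h1.pow 2)))
      refine ⟨h1', ?_, ?_⟩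
      · have h : X (k + 1 + 1) - X (k + 1) = B * (A1 * (X (k + 1) * (X (k + 1) - X k) +
            (X (k + 1) - X k) * X k)) := by
          rw [hX (k + 1)]
          nth_rewrite 2 [hX k]
          exact quadratic_step_sub (R := Linf →L[ℝ] Linf) B Am1 A1 (X (k + 1)) (X k)
        rw [h]
        exact hB.mul (hA1.mul ((h1'.mul h2).add (h2.mul h1)))
      · rw [hdiff k]
        exact hB.mul (hA1.mul ((hG.mul h3).add (h3.mul h1)))
  have hK : OpPos (B * (A1 + A1 * G)) := hB.mul (hA1.add (hA1.mul hG))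
  have hrate : ∀ k, ‖G - X (k + 1)‖ ≤ ‖B * (A1 + A1 * G)‖ * ‖G - X k‖ := by
    intro k
    obtain ⟨-, -, h3⟩ := hpos k
    refine le_trans ((hpos (k + 1)).2.2.norm_le fun i => ?_) ((B * (A1 + A1 * G)).opNorm_comp_le (G - X k))
    refine le_trans ?_ (OpPos.apply_ones_le_norm _ i)
    have hX1 : ∀ j, X k ones j ≤ ones j := fun j => by
      have := h3.apply_ones_nonneg j
      simpa [hG1] using this
    rw [hdiff k]
    refine hB.mono (fun j => ?_) i
    have h : (A1 + A1 * G) ((G - X k) ones) =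
        A1 (G ((G - X k) ones) + (G - X k) ones) := by
      rw [map_add, add_comm]; rfl
    change _ ≤ (A1 + A1 * G) ((G - X k) ones) j
    rw [h]
    exact hA1.mono (fun l => add_le_add_right (h3.mono hX1 l) _) j
  have hKσ : ‖B * (A1 + A1 * G)‖ ≤ σ := by
    refine hK.norm_le fun i => ?_
    have hBge : (1 : ℝ) ≤ B ones i := by
      have h : B = 1 + B * A0 := eq_one_add_mul_of_mul_one_sub (R := Linf →L[ℝ] Linf) hB2
      have h0 := (hB.mul hA0).apply_ones_nonneg i
      rw [h]
      simpa [ones] using h0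
    have hmono := hB.mono (x := (A1 + A1 * G) ones + (1 - σ) • ones) (y := (1 - A0) ones)
      (fun j => by
        have h1 : ones j = 1 := rfl
        simp [hG1, h1]
        linarith [hst j, hgap' j]) i
    have h1 : B ((1 - A0) ones) = ones := congrArg (fun T : Linf →L[ℝ] Linf => T ones) hB2
    rw [h1, map_add, map_smul] at hmono
    have h2 : B ((A1 + A1 * G) ones) i + (1 - σ) * B ones i ≤ 1 := hmono
    have h3 : (1 - σ) * 1 ≤ (1 - σ) * B ones i :=
      mul_le_mul_of_nonneg_left hBge (by linarith)
    change B ((A1 + A1 * G) ones) i ≤ σ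
    linarith
  refine ⟨hpos, hrate, ?_⟩
  have hgeo : ∀ k, ‖G - X k‖ ≤ σ ^ k * ‖G - X 0‖ := by
    intro k
    induction k with
    | zero => simp
    | succ k ih =>
      calc ‖G - X (k + 1)‖ ≤ σ * ‖G - X k‖ :=
            (hrate k).trans (mul_le_mul_of_nonneg_right hKσ (norm_nonneg (G - X k)))
        _ ≤ σ * (σ ^ k * ‖G - X 0‖) := mul_le_mul_of_nonneg_left ih hσ0
        _ = σ ^ (k + 1) * ‖G - X 0‖ := by ring
  refine squeeze_zero (fun k => norm_nonneg (G - X k)) hgeo ?_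
  simpa using (tendsto_pow_atTop_nhds_zero_of_lt_one hσ0 hσ).mul_const ‖G - X 0‖
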